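/- With the lattice models of the context: for any Θ₁,…,Θ_{r−1} ∈ {L,R}, any μ = (μ₁ > … > μ_r ≥ 0) with μ₁ < Nm and any σ ∈ {1,…,m}^r, Z^{(Θ₁,…,Θ_{r−1},R),N}_{μ,σ}(z₁,…,z_r) = z_r^N · Z^{(Θ₁,…,Θ_{r−1},L),N}_{μ,σ}(z₁,…,z_r); that is, the partition function with last row right-moving equals z_r^N times the partition function with last row left-moving and all other data unchanged. -/

import Mathlib

namespace Lattice

/-- Row types: left-moving (`L`) and right-moving (`R`). -/
inductive RowType | L | R
deriving DecidableEq

/-- An index for the independent indeterminates `X_{i,j}` with `1 ≤ i < j ≤ m`. -/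
structure XIdx (m : ℕ) where
  i : ℕ
  j : ℕ
  hi : 1 ≤ i
  hij : i < j
  hj : j ≤ m

/-- The indeterminates `q`, `Φ`, `z₁, …, z_r` and `X_{i,j}` for `1 ≤ i < j ≤ m`. -/
abbrev Vars (m r : ℕ) := Unit ⊕ Unit ⊕ Fin r ⊕ XIdx m

/-- The field of rational functions over `ℚ` in the indeterminates `Vars m r`. -/
abbrev K (m r : ℕ) := FractionRing (MvPolynomial (Vars m r) ℚ)

noncomputable def vr (m r : ℕ) (v : Vars m r) : K m r :=
  algebraMap (MvPolynomial (Vars m r) ℚ) (K m r) (MvPolynomial.X v)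

/-- The indeterminate `q`. -/
noncomputable def qv (m r : ℕ) : K m r := vr m r (Sum.inl ())

/-- The indeterminate `Φ`. -/
noncomputable def Φv (m r : ℕ) : K m r := vr m r (Sum.inr (Sum.inl ()))

/-- The indeterminate `z_t` (`0`-based: `zv m r t` is the row parameter of row `t+1`). -/
noncomputable def zv (m r : ℕ) (t : Fin r) : K m r := vr m r (Sum.inr (Sum.inr (Sum.inl t)))

/-- The indeterminate `X_{i,j}` for `1 ≤ i < j ≤ m`. -/
noncomputable def Xv (m r : ℕ) (idx : XIdx m) : K m r := vr m r (Sum.inr (Sum.inr (Sum.inr idx)))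

/-- `𝔛_{i,j}`: equal to `X_{i,j}` for `i < j`, to `q²X_{j,i}⁻¹` for `i > j`, and to `−q²`
for `i = j` (colors in range `1 ≤ i, j ≤ m`). -/
noncomputable def Xfrak (m r : ℕ) (i j : ℕ) : K m r :=
  if h : 1 ≤ i ∧ i < j ∧ j ≤ m then Xv m r ⟨i, j, h.1, h.2.1, h.2.2⟩
  else if h' : 1 ≤ j ∧ j < i ∧ i ≤ m then
    (qv m r) ^ 2 * (Xv m r ⟨j, i, h'.1, h'.2.1, h'.2.2⟩)⁻¹
  else -(qv m r) ^ 2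

/-- The vertex weight of the configuration `(left, top, right, bottom) = (a,b,c,d)` for a
vertex of row type `ty` with row parameter `z` in a column of column color `c_j`. -/
noncomputable def wtVertex (m r : ℕ) (ty : RowType) (z : K m r) (j : ℕ) (a b c d : ℕ) :
    K m r :=
  match ty with
  | .R =>
      if a = 0 ∧ b = 0 ∧ c = 0 ∧ d = 0 then 1
      else if a ≠ 0 ∧ b = j ∧ c = a ∧ d = j then
        Φv m r * Xfrak m r a j * (if a = j then z else 1)
      else if a = 0 ∧ b = j ∧ c = 0 ∧ d = j then Φv m r
      else if a ≠ 0 ∧ b = 0 ∧ c = a ∧ d = 0 then (if a = j then z else 1)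
      else if a = j ∧ b = 0 ∧ c = 0 ∧ d = j then Φv m r * (1 - (qv m r) ^ 2) * z
      else if a = 0 ∧ b = j ∧ c = j ∧ d = 0 then 1
      else 0
  | .L =>
      if a = 0 ∧ b = 0 ∧ c = 0 ∧ d = 0 then 1
      else if a ≠ 0 ∧ b = j ∧ c = a ∧ d = j then
        Φv m r * Xfrak m r j a * (if a = j then z⁻¹ else 1)
      else if a = 0 ∧ b = j ∧ c = 0 ∧ d = j then Φv m r
      else if a ≠ 0 ∧ b = 0 ∧ c = a ∧ d = 0 then (if a = j then z⁻¹ else 1)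
      else if a = 0 ∧ b = 0 ∧ c = j ∧ d = j then Φv m r * (1 - (qv m r) ^ 2)
      else if a = j ∧ b = j ∧ c = 0 ∧ d = 0 then z⁻¹
      else 0

/-- A state: spins on horizontal and vertical edges of the grid with `r` rows and `Nc`
columns. -/
abbrev St (m r Nc : ℕ) :=
  (Fin r → Fin (Nc + 1) → Fin (m + 1)) × (Fin (r + 1) → Fin Nc → Fin (m + 1))

/-- The column number of the column at position `p` from the left
(columns are numbered `Nc−1, …, 1, 0` from left to right). -/
def colNum (Nc : ℕ) (p : Fin Nc) : ℕ := Nc - 1 - (p : ℕ)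

/-- The column color of the column at position `p`: the column numbered `x` has column
color `c_{m − (x mod m)}`. -/
def colColor (m Nc : ℕ) (p : Fin Nc) : ℕ := m - colNum Nc p % m

/-- The Boltzmann weight of a state, with row types `Θ` and row parameters `w`. -/
noncomputable def wtState (m r Nc : ℕ) (Θ : Fin r → RowType) (w : Fin r → K m r)
    (s : St m r Nc) : K m r :=
  ∏ t : Fin r, ∏ p : Fin Nc,
    wtVertex m r (Θ t) (w t) (colColor m Nc p)
      (s.1 t p.castSucc : ℕ) (s.2 t.castSucc p : ℕ) (s.1 t p.succ : ℕ) (s.2 t.succ p : ℕ)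

/-- The boundary conditions of the system `𝔖^{Θ,N}_{μ,σ}`. -/
def bc (m r Nc : ℕ) (Θ : Fin r → RowType) (μ σ : Fin r → ℕ) (s : St m r Nc) : Prop :=
  (∀ p : Fin Nc,
      (s.2 0 p : ℕ) = if ∃ t : Fin r, μ t = colNum Nc p then colColor m Nc p else 0) ∧
  (∀ p : Fin Nc, s.2 (Fin.last r) p = 0) ∧
  (∀ t : Fin r,
    (Θ t = RowType.R → (s.1 t 0 : ℕ) = 0 ∧ (s.1 t (Fin.last Nc) : ℕ) = σ t) ∧
    (Θ t = RowType.L → (s.1 t (Fin.last Nc) : ℕ) = 0 ∧ (s.1 t 0 : ℕ) = σ t))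

/-- The partition function `Z^{Θ,N}_{μ,σ}(w₁,…,w_r)`: the sum of the weights of all states
satisfying the boundary conditions. -/
noncomputable def Z (m r Nc : ℕ) (Θ : Fin r → RowType) (w : Fin r → K m r)
    (μ σ : Fin r → ℕ) : K m r :=
  ∑ s : St m r Nc,
    @ite _ (bc m r Nc Θ μ σ s) (Classical.propDecidable _) (wtState m r Nc Θ w s) 0

lemma zv_ne_zero (m r : ℕ) (t : Fin r) : zv m r t ≠ 0 := by
  unfold zv vr
  rw [Ne, IsFractionRing.to_map_eq_zero_iff]
  exact MvPolynomial.X_ne_zero _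

lemma one_le_colColor {m Nc : ℕ} (hm : 1 ≤ m) (p : Fin Nc) : 1 ≤ colColor m Nc p := by
  have := Nat.mod_lt (colNum Nc p) hm
  unfold colColor
  omega

/-- Every color occurs as the column color of exactly `N` of the `N * m` columns. -/
lemma prod_colColor {M : Type*} [CommMonoid M] (m N σ : ℕ) (hσ : 1 ≤ σ) (hσm : σ ≤ m) (z : M) :
    ∏ p : Fin (N * m), (if colColor m (N * m) p = σ then z else 1) = z ^ N := by
  rw [← Equiv.prod_comp Fin.revPerm, ← Equiv.prod_comp finProdFinEquiv, Fintype.prod_prod_type]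
  have key (x : Fin N) (y : Fin m) :
      colColor m (N * m) (Fin.revPerm (finProdFinEquiv (x, y))) = σ ↔
        y = ⟨m - σ, by omega⟩ := by
    have hlt := (finProdFinEquiv (x, y)).isLt
    have hcol : colNum (N * m) (Fin.revPerm (finProdFinEquiv (x, y))) = y + m * x := by
      have hval : (finProdFinEquiv (x, y) : ℕ) = y + m * x := rfl
      simp only [colNum, Fin.revPerm_apply, Fin.val_rev]
      omega
    have hy := y.isLt
    rw [colColor, hcol, Nat.add_mul_mod_self_left, Nat.mod_eq_of_lt hy, Fin.ext_iff]
    dsimp only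
    omega
  simp only [key, Finset.prod_ite_eq', Finset.mem_univ, if_true, Finset.prod_const,
    Finset.card_univ, Fintype.card_fin]

section Vertex

variable {m r : ℕ} {z : K m r} {j : ℕ}

/-- In a right-moving vertex with empty bottom edge, an occupied left edge passes through. -/
lemma eq_of_wtVertex_R_ne_zero (hj : 1 ≤ j) {a b c : ℕ}
    (h : wtVertex m r .R z j a b c 0 ≠ 0) : a = 0 ∨ a = c := by
  by_contra! hac
  apply h
  simp only [wtVertex]
  split_ifs <;> first | rfl | omega

/-- In a left-moving vertex with empty bottom edge, an occupied right edge passes through. -/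
lemma eq_of_wtVertex_L_ne_zero (hj : 1 ≤ j) {a b c : ℕ}
    (h : wtVertex m r .L z j a b c 0 ≠ 0) : c = 0 ∨ c = a := by
  by_contra! hac
  apply h
  simp only [wtVertex]
  split_ifs <;> first | rfl | omega

/-- Swapping the spins `0` and `σ` on the horizontal edges turns right-moving weights into
left-moving ones, up to a factor `z` in columns of color `σ`. -/
lemma wtVertex_R_eq_wtVertex_L (hz : z ≠ 0) (hj : 1 ≤ j) {σ : ℕ} (hσ : 1 ≤ σ) (a b c : ℕ)
    (ha : a = 0 ∨ a = σ) (hc : c = 0 ∨ c = σ) :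
    wtVertex m r .R z j a b c 0 =
      (if j = σ then z else 1) *
        wtVertex m r .L z j (Equiv.swap 0 σ a) b (Equiv.swap 0 σ c) 0 := by
  have hσ0 : σ ≠ 0 := by omega
  have hj0 : j ≠ 0 := by omega
  rcases ha with ha | ha <;> rcases hc with hc | hc <;> subst a c <;>
    simp only [wtVertex, Equiv.swap_apply_left, Equiv.swap_apply_right] <;>
    by_cases hb : b = 0 <;> by_cases hjσ : j = σ <;>
    simp [hb, hjσ, hσ0, hσ0.symm, hj0.symm, hz, eq_comm (a := σ)]

end Vertex

lemma forall_of_prod_wtVertex_R_ne_zero {m r n σ : ℕ} {z : K m r} {col b : Fin n → ℕ}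
    (hcol : ∀ p, 1 ≤ col p) (h : Fin (n + 1) → ℕ) (hlast : h (Fin.last n) = σ)
    (hne : ∏ p, wtVertex m r .R z (col p) (h p.castSucc) (b p) (h p.succ) 0 ≠ 0)
    (p : Fin (n + 1)) : h p = 0 ∨ h p = σ := by
  rw [Finset.prod_ne_zero_iff] at hne
  induction p using Fin.reverseInduction with
  | last => exact Or.inr hlast
  | cast i ih =>
    have := eq_of_wtVertex_R_ne_zero (hcol i) (hne i (Finset.mem_univ _))
    omega

lemma forall_of_prod_wtVertex_L_ne_zero {m r n σ : ℕ} {z : K m r} {col b : Fin n → ℕ}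
    (hcol : ∀ p, 1 ≤ col p) (h : Fin (n + 1) → ℕ) (hfirst : h 0 = σ)
    (hne : ∏ p, wtVertex m r .L z (col p) (h p.castSucc) (b p) (h p.succ) 0 ≠ 0)
    (p : Fin (n + 1)) : h p = 0 ∨ h p = σ := by
  rw [Finset.prod_ne_zero_iff] at hne
  induction p using Fin.induction with
  | zero => exact Or.inr hfirst
  | succ i ih =>
    have := eq_of_wtVertex_L_ne_zero (hcol i) (hne i (Finset.mem_univ _))
    omega

lemma swap_eq_zero_or_eq_iff {α : Type*} [DecidableEq α] (x y a : α) :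
    (Equiv.swap x y a = x ∨ Equiv.swap x y a = y) ↔ (a = x ∨ a = y) := by
  rw [Equiv.swap_apply_eq_iff, Equiv.swap_apply_eq_iff, Equiv.swap_apply_left,
    Equiv.swap_apply_right, or_comm]

/-- The row identity: swapping `0` and `σ` relates a right-moving and a left-moving row with
empty bottom edges. -/
lemma prod_wtVertex_R_eq {m r N σ : ℕ} {z : K m r} (hz : z ≠ 0) (hσ : 1 ≤ σ) (hσm : σ ≤ m)
    (b : Fin (N * m) → ℕ) (h : Fin (N * m + 1) → ℕ)
    (hfirst : h 0 = 0) (hlast : h (Fin.last _) = σ) :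
    ∏ p, wtVertex m r .R z (colColor m (N * m) p) (h p.castSucc) (b p) (h p.succ) 0 =
      z ^ N * ∏ p, wtVertex m r .L z (colColor m (N * m) p) (Equiv.swap 0 σ (h p.castSucc)) (b p)
        (Equiv.swap 0 σ (h p.succ)) 0 := by
  have hcol : ∀ p, 1 ≤ colColor m (N * m) p := one_le_colColor (hσ.trans hσm)
  by_cases hall : ∀ p, h p = 0 ∨ h p = σ
  · rw [← prod_colColor m N σ hσ hσm z, ← Finset.prod_mul_distrib]
    exact Finset.prod_congr rfl fun p _ =>
      wtVertex_R_eq_wtVertex_L hz (hcol p) hσ _ _ _ (hall _) (hall _)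
  · have hR : ∏ p, wtVertex m r .R z (colColor m (N * m) p) (h p.castSucc) (b p) (h p.succ) 0
        = 0 := by
      by_contra hne
      exact hall (forall_of_prod_wtVertex_R_ne_zero hcol h hlast hne)
    have hL : ∏ p, wtVertex m r .L z (colColor m (N * m) p) (Equiv.swap 0 σ (h p.castSucc)) (b p)
        (Equiv.swap 0 σ (h p.succ)) 0 = 0 := by
      by_contra hne
      refine hall fun p => (swap_eq_zero_or_eq_iff 0 σ (h p)).1 ?_
      exact forall_of_prod_wtVertex_L_ne_zero hcol (fun p => Equiv.swap 0 σ (h p))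
        (by simp [hfirst]) hne p
    rw [hR, hL, mul_zero]

/-- Permuting the spins on the horizontal edges of row `l`. -/
def permRow {m r Nc : ℕ} (l : Fin r) (e : Equiv.Perm (Fin (m + 1))) : St m r Nc ≃ St m r Nc :=
  Equiv.prodCongr
    (Equiv.piCongrRight fun t =>
      if t = l then Equiv.piCongrRight fun _ => e else Equiv.refl _)
    (Equiv.refl _)

lemma permRow_snd {m r Nc : ℕ} (l : Fin r) (e : Equiv.Perm (Fin (m + 1))) (s : St m r Nc) :
    (permRow l e s).2 = s.2 := rfl

lemma permRow_fst_self {m r Nc : ℕ} (l : Fin r) (e : Equiv.Perm (Fin (m + 1))) (s : St m r Nc)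
    (p : Fin (Nc + 1)) : (permRow l e s).1 l p = e (s.1 l p) := by
  simp [permRow]

lemma permRow_fst_of_ne {m r Nc : ℕ} {l t : Fin r} (h : t ≠ l) (e : Equiv.Perm (Fin (m + 1)))
    (s : St m r Nc) (p : Fin (Nc + 1)) : (permRow l e s).1 t p = s.1 t p := by
  simp [permRow, h]

lemma val_swap_zero {m : ℕ} (x a : Fin (m + 1)) :
    ((Equiv.swap 0 x a : Fin (m + 1)) : ℕ) = Equiv.swap 0 (x : ℕ) (a : ℕ) := by
  simp only [Equiv.swap_apply_def, Fin.ext_iff, Fin.val_zero]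
  split_ifs <;> rfl

lemma bc_permRow_iff {m r Nc : ℕ} (Θ : Fin r → RowType) (μ σ : Fin r → ℕ) (l : Fin r)
    (x : Fin (m + 1)) (hx : (x : ℕ) = σ l) (s : St m r Nc) :
    bc m r Nc (Function.update Θ l .L) μ σ (permRow l (Equiv.swap 0 x) s) ↔
      bc m r Nc (Function.update Θ l .R) μ σ s := by
  unfold bc
  rw [permRow_snd]
  refine and_congr_right fun _ => and_congr_right fun _ => forall_congr' fun t => ?_
  by_cases ht : t = l
  · subst ht
    have h0 (a : Fin (m + 1)) : ((Equiv.swap 0 x a : Fin (m + 1)) : ℕ) = 0 ↔ (a : ℕ) = σ t := by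
      rw [val_swap_zero, hx, Equiv.swap_apply_eq_iff, Equiv.swap_apply_left]
    have h1 (a : Fin (m + 1)) : ((Equiv.swap 0 x a : Fin (m + 1)) : ℕ) = σ t ↔ (a : ℕ) = 0 := by
      rw [val_swap_zero, hx, Equiv.swap_apply_eq_iff, Equiv.swap_apply_right]
    simp [permRow_fst_self, h0, h1, and_comm]
  · simp [ht, permRow_fst_of_ne ht]

lemma wtState_permRow {m r N : ℕ} (Θ : Fin r → RowType) (w : Fin r → K m r) (μ σ : Fin r → ℕ)
    (l : Fin r) (hl : l.succ = Fin.last r) (hw : w l ≠ 0) (x : Fin (m + 1)) (hx : (x : ℕ) = σ l)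
    (hσ : 1 ≤ σ l) (s : St m r (N * m))
    (hs : bc m r (N * m) (Function.update Θ l .R) μ σ s) :
    wtState m r (N * m) (Function.update Θ l .R) w s =
      w l ^ N * wtState m r (N * m) (Function.update Θ l .L) w
        (permRow l (Equiv.swap 0 x) s) := by
  obtain ⟨-, hbot, hrow⟩ := hs
  have hpow : w l ^ N = ∏ t : Fin r, if t = l then w l ^ N else 1 := by simp
  unfold wtState
  rw [hpow, ← Finset.prod_mul_distrib]
  refine Finset.prod_congr rfl fun t _ => ?_
  by_cases ht : t = l
  · subst ht
    have hbdry := (hrow t).1 (by simp)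
    simp only [Function.update_self, permRow_snd, permRow_fst_self, val_swap_zero, hx, hl, hbot,
      Fin.val_zero, if_true]
    exact prod_wtVertex_R_eq hw hσ (hx ▸ Nat.lt_succ_iff.1 x.isLt)
      (fun p => s.2 t.castSucc p) (fun p => s.1 t p) hbdry.1 hbdry.2
  · simp [ht, permRow_snd, permRow_fst_of_ne ht]

/-- The partition function with right-moving last row equals `z_r^N` times
the partition function with left-moving last row, all other data unchanged. -/
theorem last_row (m r N : ℕ) (hm : 1 ≤ m) (hr : 1 ≤ r) (hN : 1 ≤ N)
    (μ : Fin r → ℕ) (hμdec : ∀ s t : Fin r, s < t → μ t < μ s)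
    (hμN : ∀ t : Fin r, μ t < N * m)
    (σ : Fin r → ℕ) (hσ : ∀ t : Fin r, 1 ≤ σ t ∧ σ t ≤ m)
    (Θ : Fin r → RowType) :
    Z m r (N * m) (Function.update Θ (⟨r - 1, by omega⟩ : Fin r) RowType.R) (zv m r) μ σ
      = (zv m r ⟨r - 1, by omega⟩) ^ N *
        Z m r (N * m) (Function.update Θ (⟨r - 1, by omega⟩ : Fin r) RowType.L)
          (zv m r) μ σ := by
  have hσl := hσ ⟨r - 1, by omega⟩
  set l : Fin r := ⟨r - 1, by omega⟩
  have hl : l.succ = Fin.last r := by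
    ext
    simp [l]
    omega
  let x : Fin (m + 1) := ⟨σ l, by omega⟩
  unfold Z
  rw [Finset.mul_sum]
  refine Fintype.sum_equiv (permRow l (Equiv.swap 0 x)) _ _ fun s => ?_
  by_cases hs : bc m r (N * m) (Function.update Θ l .R) μ σ s
  · rw [if_pos hs, if_pos ((bc_permRow_iff Θ μ σ l x rfl s).2 hs)]
    exact wtState_permRow Θ _ μ σ l hl (zv_ne_zero m r l) x rfl hσl.1 s hs
  · rw [if_neg hs, if_neg (mt (bc_permRow_iff Θ μ σ l x rfl s).1 hs), mul_zero]

end Lattice
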